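/- Let S be a finite nonempty set, let n ≥ 1, let μ be a probability distribution on Fin n → S, and let s ≥ 1 be an integer. Then there exists a subset T ⊆ Fin n with |T| ≤ s such that, writing μ^z for μ conditioned on the event {x_T = z}, one has ∑_{z ∈ supp(μ_T)} μ_T(z) · (1/n²)·∑_{i,j ∈ Fin n} TV(μ^z_{ij}, μ^z_i ⊗ μ^z_j) ≤ √(log|S| / s). -/

import Mathlib

open Finset

/-- The distribution `μ` conditioned on the event that the coordinates in `T`
agree with `y`. -/
noncomputable def condDist {n : ℕ} {S : Type*} [Fintype S] [DecidableEq S]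
    (μ : (Fin n → S) → ℝ) (T : Finset (Fin n)) (y : Fin n → S) :
    (Fin n → S) → ℝ := fun x =>
  if ∀ i ∈ T, x i = y i then
    μ x / ∑ x' ∈ univ.filter (fun x' : Fin n → S => ∀ i ∈ T, x' i = y i), μ x'
  else 0

/-- The joint marginal law of the coordinate pair `(x_i, x_j)`. -/
noncomputable def margPair {n : ℕ} {S : Type*} [Fintype S] [DecidableEq S]
    (ν : (Fin n → S) → ℝ) (i j : Fin n) : S × S → ℝ := fun ab =>
  ∑ x ∈ univ.filter (fun x : Fin n → S => x i = ab.1 ∧ x j = ab.2), ν x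

/-- The marginal law of the coordinate `x_i`. -/
noncomputable def margOne {n : ℕ} {S : Type*} [Fintype S] [DecidableEq S]
    (ν : (Fin n → S) → ℝ) (i : Fin n) : S → ℝ := fun a =>
  ∑ x ∈ univ.filter (fun x : Fin n → S => x i = a), ν x

/-- Total variation distance between two mass functions on `S × S`. -/
noncomputable def tvFin {S : Type*} [Fintype S] (α β : S × S → ℝ) : ℝ :=
  (1 / 2) * ∑ ab, |α ab - β ab|

/-- Mass of the event of agreeing with `y` on `T`. -/
noncomputable def pinM {n : ℕ} {S : Type*} [Fintype S] [DecidableEq S]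
    (μ : (Fin n → S) → ℝ) (T : Finset (Fin n)) (y : Fin n → S) : ℝ :=
  ∑ x' ∈ univ.filter (fun x' : Fin n → S => ∀ i ∈ T, x' i = y i), μ x'

/-- Entropy of the coordinates in `T`. -/
noncomputable def pinH {n : ℕ} {S : Type*} [Fintype S] [DecidableEq S]
    (μ : (Fin n → S) → ℝ) (T : Finset (Fin n)) : ℝ :=
  - ∑ y, μ y * Real.log (pinM μ T y)

lemma pin_pinsker_term (p q : ℝ) (hp : 0 ≤ p) (hq : 0 ≤ q) (h : q = 0 → p = 0) :
    2 * p - 2 * (√p * √q) ≤ p * Real.log (p / q) := by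
  rcases hp.eq_or_lt with rfl | hp'
  · simp
  have hq' : 0 < q := by
    rcases hq.eq_or_lt with h0 | h0
    · exact absurd (h h0.symm) hp'.ne'
    · exact h0
  have sp := Real.sqrt_pos.mpr hp'
  have sq := Real.sqrt_pos.mpr hq'
  have h1 := Real.log_le_sub_one_of_pos (div_pos sq sp)
  rw [Real.log_div sq.ne' sp.ne', Real.log_sqrt hq, Real.log_sqrt hp] at h1
  rw [Real.log_div hp'.ne' hq'.ne']
  have h2 : p * (√q / √p) = √p * √q := by
    have := Real.mul_self_sqrt hp
    field_simp
    nlinarith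
  nlinarith [mul_le_mul_of_nonneg_left h1 hp]

lemma pin_pinsker {α : Type*} [Fintype α] (p q : α → ℝ) (hp : ∀ a, 0 ≤ p a) (hq : ∀ a, 0 ≤ q a)
    (hp1 : ∑ a, p a = 1) (hq1 : ∑ a, q a = 1) (h : ∀ a, q a = 0 → p a = 0) :
    ((1 / 2) * ∑ a, |p a - q a|) ^ 2 ≤ ∑ a, p a * Real.log (p a / q a) := by
  have h1 : ∑ a, (2 * p a - 2 * (√(p a) * √(q a))) ≤ ∑ a, p a * Real.log (p a / q a) :=
    sum_le_sum fun a _ => pin_pinsker_term _ _ (hp a) (hq a) (h a)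
  have h2 : (∑ a, |√(p a) - √(q a)| * (√(p a) + √(q a))) ^ 2 ≤
      (∑ a, |√(p a) - √(q a)| ^ 2) * ∑ a, (√(p a) + √(q a)) ^ 2 :=
    sum_mul_sq_le_sq_mul_sq _ _ _
  have h3 : ∀ a, |√(p a) - √(q a)| * (√(p a) + √(q a)) = |p a - q a| := by
    intro a
    rw [← abs_of_nonneg (add_nonneg (Real.sqrt_nonneg (p a)) (Real.sqrt_nonneg (q a))), ← abs_mul]
    congr 1
    nlinarith [Real.mul_self_sqrt (hp a), Real.mul_self_sqrt (hq a)]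
  simp only [h3] at h2
  set B := ∑ a, √(p a) * √(q a) with hB
  have h4 : ∑ a, |√(p a) - √(q a)| ^ 2 = 2 - 2 * B := by
    have : ∀ a, |√(p a) - √(q a)| ^ 2 = p a + q a - 2 * (√(p a) * √(q a)) := by
      intro a
      rw [sq_abs]
      nlinarith [Real.mul_self_sqrt (hp a), Real.mul_self_sqrt (hq a)]
    simp only [this, sum_sub_distrib, sum_add_distrib, ← mul_sum, hp1, hq1]
    rw [hB]; ring
  have h5 : ∑ a, (√(p a) + √(q a)) ^ 2 = 2 + 2 * B := by
    have : ∀ a, (√(p a) + √(q a)) ^ 2 = p a + q a + 2 * (√(p a) * √(q a)) := by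
      intro a
      nlinarith [Real.mul_self_sqrt (hp a), Real.mul_self_sqrt (hq a)]
    simp only [this, sum_add_distrib, ← mul_sum, hp1, hq1]
    rw [hB]; ring
  simp only [sum_sub_distrib, ← mul_sum, hp1] at h1
  rw [h4, h5] at h2
  rw [← hB] at h1
  nlinarith [sq_nonneg (1 - B)]

section pin
variable {n : ℕ} {S : Type*} [Fintype S] [DecidableEq S]

lemma pinM_anti (μ : (Fin n → S) → ℝ) (hμ0 : ∀ x, 0 ≤ μ x) {T U : Finset (Fin n)} (h : T ⊆ U)
    (y : Fin n → S) : pinM μ U y ≤ pinM μ T y := by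
  unfold pinM
  apply sum_le_sum_of_subset_of_nonneg
  · intro x hx
    simp only [mem_filter, mem_univ, true_and] at hx ⊢
    exact fun i hi => hx i (h hi)
  · intros; exact hμ0 _

lemma pinM_nonneg (μ : (Fin n → S) → ℝ) (hμ0 : ∀ x, 0 ≤ μ x) (T : Finset (Fin n))
    (y : Fin n → S) : 0 ≤ pinM μ T y := sum_nonneg fun _ _ => hμ0 _

lemma pinM_ge (μ : (Fin n → S) → ℝ) (hμ0 : ∀ x, 0 ≤ μ x) (T : Finset (Fin n))
    (y : Fin n → S) : μ y ≤ pinM μ T y := by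
  unfold pinM
  exact single_le_sum (f := μ) (fun x _ => hμ0 x) (by simp)

lemma pinM_congr (μ : (Fin n → S) → ℝ) (T : Finset (Fin n))
    (x y : Fin n → S) (h : ∀ i ∈ T, x i = y i) : pinM μ T x = pinM μ T y := by
  unfold pinM
  congr 1
  ext z
  simp only [mem_filter, mem_univ, true_and]
  exact forall₂_congr fun i hi => by rw [h i hi]

lemma pinH_mono (μ : (Fin n → S) → ℝ) (hμ0 : ∀ x, 0 ≤ μ x) {T U : Finset (Fin n)} (h : T ⊆ U) :
    pinH μ T ≤ pinH μ U := by
  unfold pinH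
  apply neg_le_neg
  apply sum_le_sum
  intro y _
  rcases (hμ0 y).eq_or_lt with h0 | h0
  · simp [← h0]
  · exact mul_le_mul_of_nonneg_left (Real.log_le_log (h0.trans_le (pinM_ge μ hμ0 U y))
      (pinM_anti μ hμ0 h y)) h0.le

lemma pinH_empty (μ : (Fin n → S) → ℝ) (hμ1 : ∑ x, μ x = 1) : pinH μ ∅ = 0 := by
  simp [pinH, pinM, hμ1]

lemma pinH_single [Nonempty S] (μ : (Fin n → S) → ℝ) (hμ0 : ∀ x, 0 ≤ μ x) (hμ1 : ∑ x, μ x = 1)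
    (i : Fin n) : pinH μ (insert i ∅) ≤ Real.log (Fintype.card S) := by
  set c : ℝ := (Fintype.card S : ℝ) with hc
  have hc0 : 0 < c := by rw [hc]; exact_mod_cast Fintype.card_pos
  set M := pinM μ (insert i ∅) with hM
  have key : ∀ y, μ y * (- Real.log (M y)) ≤ μ y * Real.log c + (c⁻¹ * (μ y / M y) - μ y) := by
    intro y
    rcases (hμ0 y).eq_or_lt with h0 | h0
    · simp [← h0]
    have hm : 0 < M y := h0.trans_le (pinM_ge μ hμ0 _ y)
    have := Real.log_le_sub_one_of_pos (inv_pos.mpr (mul_pos hc0 hm))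
    rw [Real.log_inv, Real.log_mul hc0.ne' hm.ne'] at this
    have h2 := mul_le_mul_of_nonneg_left this h0.le
    have h3 : μ y * (c * M y)⁻¹ = c⁻¹ * (μ y / M y) := by field_simp
    nlinarith
  have h2 : ∑ y, μ y / M y ≤ c := by
    rw [← sum_fiberwise (s := univ) (g := fun y : Fin n → S => y i)]
    calc _ ≤ ∑ a : S, (1 : ℝ) := ?_
      _ = c := by simp [hc]
    apply sum_le_sum
    intro a _
    set m := ∑ x ∈ univ.filter (fun x : Fin n → S => x i = a), μ x with hm
    have : ∀ y ∈ univ.filter (fun x : Fin n → S => x i = a), μ y / M y = μ y / m := by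
      intro y hy
      simp only [mem_filter, mem_univ, true_and] at hy
      congr 1
      rw [hM, pinM, hm]
      simp [hy]
    rw [sum_congr rfl this, ← sum_div]
    exact div_self_le_one _
  have h3 := sum_le_sum fun y (_ : y ∈ univ) => key y
  simp only [sum_add_distrib, sum_sub_distrib, ← mul_sum, ← sum_mul, hμ1, mul_neg,
    sum_neg_distrib] at h3
  have h4 : c⁻¹ * ∑ y, μ y / M y ≤ 1 := by
    calc _ ≤ c⁻¹ * c := by gcongr
      _ = 1 := inv_mul_cancel₀ hc0.ne'
  unfold pinH
  rw [← hM]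
  linarith

/-- Sum of all conditional mutual informations. -/
noncomputable def pinI (μ : (Fin n → S) → ℝ) (T : Finset (Fin n)) (i j : Fin n) : ℝ :=
  pinH μ (insert i T) + pinH μ (insert j T) - pinH μ (insert i (insert j T)) - pinH μ T

lemma pin_exists [Nonempty S] (hn : 1 ≤ n) (μ : (Fin n → S) → ℝ) (hμ0 : ∀ x, 0 ≤ μ x)
    (hμ1 : ∑ x, μ x = 1) (s : ℕ) (hs : 1 ≤ s) :
    ∃ T : Finset (Fin n), T.card ≤ s ∧
      (1 / (n : ℝ) ^ 2) * ∑ i, ∑ j, pinI μ T i j ≤ Real.log (Fintype.card S) / s := by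
  by_contra! hcon
  set L := Real.log (Fintype.card S) with hL
  have hn0 : (0 : ℝ) < n := by exact_mod_cast hn
  have hs0 : (0 : ℝ) < s := by exact_mod_cast hs
  let A : Finset (Fin n) → ℝ := fun T => ∑ i, (pinH μ (insert i T) - pinH μ T)
  have hA : ∀ T, 0 ≤ A T := fun T => sum_nonneg fun i _ =>
    sub_nonneg.mpr (pinH_mono μ hμ0 (subset_insert _ _))
  have hI : ∀ T, ∑ i, ∑ j, pinI μ T i j = n * A T - ∑ j, A (insert j T) := by
    intro T
    simp only [A, pinI, sum_sub_distrib, sum_add_distrib, sum_const, card_univ, Fintype.card_fin,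
      nsmul_eq_mul, ← mul_sum]
    rw [sum_comm (f := fun i j => pinH μ (insert i (insert j T)))]
    ring
  have step : ∀ T : Finset (Fin n), T.card ≤ s → ∃ j, A (insert j T) < A T - n * (L / s) := by
    intro T hT
    by_contra! hc
    have h1 := hcon T hT
    rw [hI] at h1
    have h2 := sum_le_sum fun j (_ : j ∈ univ) => hc j
    simp only [sum_const, card_univ, Fintype.card_fin, nsmul_eq_mul] at h2
    have h3 : 1 / (n : ℝ) ^ 2 * (n * A T - ∑ j, A (insert j T)) ≤
      1 / (n : ℝ) ^ 2 * ((n : ℝ) ^ 2 * (L / s)) := by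
      apply mul_le_mul_of_nonneg_left _ (by positivity)
      nlinarith
    have h4 : 1 / (n : ℝ) ^ 2 * ((n : ℝ) ^ 2 * (L / s)) = L / s := by field_simp
    linarith
  have h0 : A ∅ ≤ n * L := by
    have : ∀ i ∈ (univ : Finset (Fin n)), pinH μ (insert i ∅) - pinH μ ∅ ≤ L := by
      intro i _
      rw [pinH_empty μ hμ1, sub_zero]
      exact pinH_single μ hμ0 hμ1 i
    have := sum_le_sum this
    simpa [A] using this
  have ind : ∀ k ≤ s, ∃ T : Finset (Fin n), T.card ≤ k ∧ A T ≤ n * L - k * (n * (L / s)) := by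
    intro k
    induction k with
    | zero => intro _; exact ⟨∅, by simp, by simpa using h0⟩
    | succ k ih =>
      intro hk
      obtain ⟨T, hT, hAT⟩ := ih (by omega)
      obtain ⟨j, hj⟩ := step T (by omega)
      refine ⟨insert j T, (card_insert_le _ _).trans (by omega), ?_⟩
      push_cast
      linarith
  obtain ⟨T, hT, hAT⟩ := ind s le_rfl
  obtain ⟨j, hj⟩ := step T hT
  have h5 : (s : ℝ) * (n * (L / s)) = n * L := by field_simp
  have h6 : 0 ≤ L := Real.log_natCast_nonneg _
  have h7 : 0 ≤ n * (L / s) := by positivity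
  linarith [hA (insert j T)]

lemma pin_condDist_eq (μ : (Fin n → S) → ℝ) (T : Finset (Fin n)) (y x : Fin n → S) :
    condDist μ T y x = (if ∀ i ∈ T, x i = y i then μ x else 0) / pinM μ T y := by
  unfold condDist pinM
  split_ifs <;> simp

lemma pin_margOne (μ : (Fin n → S) → ℝ) (T : Finset (Fin n)) (y x : Fin n → S)
    (h : ∀ i ∈ T, x i = y i) (i : Fin n) :
    margOne (condDist μ T y) i (x i) = pinM μ (insert i T) x / pinM μ T y := by
  simp only [margOne, pin_condDist_eq, ← sum_div]
  congr 1
  rw [← sum_filter, filter_filter]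
  unfold pinM
  congr 1
  ext z
  simp only [mem_filter, mem_univ, true_and, forall_mem_insert]
  exact and_congr Iff.rfl (forall₂_congr fun k hk => by rw [h k hk])

lemma pin_margPair (μ : (Fin n → S) → ℝ) (T : Finset (Fin n)) (y x : Fin n → S)
    (h : ∀ i ∈ T, x i = y i) (i j : Fin n) :
    margPair (condDist μ T y) i j (x i, x j)
      = pinM μ (insert i (insert j T)) x / pinM μ T y := by
  simp only [margPair, pin_condDist_eq, ← sum_div]
  congr 1
  rw [← sum_filter, filter_filter]
  unfold pinM
  congr 1
  ext z
  simp only [mem_filter, mem_univ, true_and, forall_mem_insert, and_assoc]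
  exact and_congr Iff.rfl (and_congr Iff.rfl (forall₂_congr fun k hk => by rw [h k hk]))

lemma pin_margOne_sum (ν : (Fin n → S) → ℝ) (i : Fin n) : ∑ a, margOne ν i a = ∑ x, ν x := by
  unfold margOne
  exact sum_fiberwise (s := univ) (g := fun y : Fin n → S => y i) (f := ν)

lemma pin_margPair_sum (ν : (Fin n → S) → ℝ) (i j : Fin n) (g : S × S → ℝ) :
    ∑ ab, margPair ν i j ab * g ab = ∑ x, ν x * g (x i, x j) := by
  rw [← sum_fiberwise (s := univ) (g := fun y : Fin n → S => (y i, y j))]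
  apply sum_congr rfl
  rintro ⟨a, b⟩ _
  rw [margPair, sum_mul]
  apply sum_congr
  · ext z; simp
  · intro z hz
    simp only [mem_filter, mem_univ, true_and, Prod.mk.injEq] at hz
    rw [hz.1, hz.2]

/-- Log of the conditional likelihood ratio. -/
noncomputable def pinG (μ : (Fin n → S) → ℝ) (T : Finset (Fin n)) (i j : Fin n)
    (x : Fin n → S) : ℝ :=
  Real.log (pinM μ (insert i (insert j T)) x) + Real.log (pinM μ T x)
    - Real.log (pinM μ (insert i T) x) - Real.log (pinM μ (insert j T) x)

lemma pin_tv (μ : (Fin n → S) → ℝ) (hμ0 : ∀ x, 0 ≤ μ x) (T : Finset (Fin n)) (y : Fin n → S)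
    (hy : 0 < μ y) (i j : Fin n) :
    (tvFin (margPair (condDist μ T y) i j)
      (fun ab => margOne (condDist μ T y) i ab.1 * margOne (condDist μ T y) j ab.2)) ^ 2
    ≤ ∑ x, condDist μ T y x * pinG μ T i j x := by
  have hm : 0 < pinM μ T y := hy.trans_le (pinM_ge μ hμ0 T y)
  set ν := condDist μ T y with hν
  have hν0 : ∀ x, 0 ≤ ν x := by
    intro x
    rw [hν, pin_condDist_eq]
    apply div_nonneg _ hm.le
    split_ifs
    · exact hμ0 x
    · exact le_rfl
  have hν1 : ∑ x, ν x = 1 := by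
    simp only [hν, pin_condDist_eq, ← sum_div]
    rw [← sum_filter]
    exact div_self hm.ne'
  have hone0 : ∀ i a, 0 ≤ margOne ν i a := fun i a => sum_nonneg fun x _ => hν0 x
  have hp0 : ∀ ab, 0 ≤ margPair ν i j ab := fun ab => sum_nonneg fun x _ => hν0 x
  have hle1 : ∀ ab, margPair ν i j ab ≤ margOne ν i ab.1 := fun ab =>
    sum_le_sum_of_subset_of_nonneg (fun x hx => by
      simp only [mem_filter, mem_univ, true_and] at hx ⊢; exact hx.1) (fun x _ _ => hν0 x)
  have hle2 : ∀ ab, margPair ν i j ab ≤ margOne ν j ab.2 := fun ab =>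
    sum_le_sum_of_subset_of_nonneg (fun x hx => by
      simp only [mem_filter, mem_univ, true_and] at hx ⊢; exact hx.2) (fun x _ _ => hν0 x)
  have hpin := pin_pinsker (margPair ν i j) (fun ab => margOne ν i ab.1 * margOne ν j ab.2) hp0
    (fun ab => mul_nonneg (hone0 _ _) (hone0 _ _))
    (by simpa [hν1] using pin_margPair_sum ν i j (fun _ => 1))
    (by
      rw [Fintype.sum_prod_type]
      simp only [← mul_sum, pin_margOne_sum, hν1, mul_one])
    (by
      intro ab h
      rcases mul_eq_zero.mp h with h | h
      · exact le_antisymm (h ▸ hle1 ab) (hp0 ab)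
      · exact le_antisymm (h ▸ hle2 ab) (hp0 ab))
  rw [pin_margPair_sum ν i j
    (fun ab => Real.log (margPair ν i j ab / (margOne ν i ab.1 * margOne ν j ab.2)))] at hpin
  refine hpin.trans (le_of_eq ?_)
  apply sum_congr rfl
  intro x _
  by_cases hx : ∀ i ∈ T, x i = y i
  · rcases (hμ0 x).eq_or_lt with h0 | h0
    · have : ν x = 0 := by rw [hν, pin_condDist_eq, ← h0]; simp
      simp [this]
    · congr 1
      have hpos : ∀ U, 0 < pinM μ U x := fun U => h0.trans_le (pinM_ge μ hμ0 U x)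
      simp only [hν, pin_margOne μ T y x hx, pin_margPair μ T y x hx]
      rw [← pinM_congr μ T x y hx, pinG]
      have e : pinM μ (insert i (insert j T)) x / pinM μ T x /
          (pinM μ (insert i T) x / pinM μ T x * (pinM μ (insert j T) x / pinM μ T x))
          = (pinM μ (insert i (insert j T)) x * pinM μ T x) /
            (pinM μ (insert i T) x * pinM μ (insert j T) x) := by
        have h1 := (hpos T).ne'
        have h2 := (hpos (insert i T)).ne'
        have h3 := (hpos (insert j T)).ne'
        field_simp
      rw [e, Real.log_div (mul_pos (hpos _) (hpos _)).ne' (mul_pos (hpos _) (hpos _)).ne',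
        Real.log_mul (hpos _).ne' (hpos _).ne', Real.log_mul (hpos _).ne' (hpos _).ne']
      ring
  · have : ν x = 0 := by rw [hν, pin_condDist_eq, if_neg hx]; simp
    simp [this]

lemma pin_tv_sum (μ : (Fin n → S) → ℝ) (hμ0 : ∀ x, 0 ≤ μ x) (T : Finset (Fin n))
    (i j : Fin n) :
    ∑ y, μ y * (tvFin (margPair (condDist μ T y) i j)
      (fun ab => margOne (condDist μ T y) i ab.1 * margOne (condDist μ T y) j ab.2)) ^ 2
    ≤ pinI μ T i j := by
  calc _ ≤ ∑ y, μ y * ∑ x, condDist μ T y x * pinG μ T i j x := by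
        apply sum_le_sum
        intro y _
        rcases (hμ0 y).eq_or_lt with h0 | h0
        · simp [← h0]
        · exact mul_le_mul_of_nonneg_left (pin_tv μ hμ0 T y h0 i j) h0.le
    _ = ∑ x, (∑ y, μ y * condDist μ T y x) * pinG μ T i j x := by
        simp only [mul_sum, sum_mul]
        rw [sum_comm]
        simp only [mul_assoc]
    _ = ∑ x, μ x * pinG μ T i j x := by
        apply sum_congr rfl
        intro x _
        congr 1
        have : ∀ y, μ y * condDist μ T y x =
            (if ∀ i ∈ T, y i = x i then μ y else 0) * (μ x / pinM μ T x) := by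
          intro y
          rw [pin_condDist_eq]
          by_cases h : ∀ i ∈ T, x i = y i
          · rw [if_pos h, if_pos (fun i hi => (h i hi).symm), pinM_congr μ T x y h]
          · rw [if_neg h, if_neg (fun h' => h fun i hi => (h' i hi).symm)]
            simp
        simp only [this, ← sum_mul]
        rw [← sum_filter]
        change pinM μ T x * _ = _
        rcases (pinM_nonneg μ hμ0 T x).eq_or_lt with h0 | h0
        · have := pinM_ge μ hμ0 T x
          rw [← h0] at this ⊢
          simp [le_antisymm this (hμ0 x)]
        · field_simp
    _ = pinI μ T i j := by
        simp only [pinG, pinI, pinH, mul_sub, mul_add, sum_sub_distrib, sum_add_distrib]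
        ring

end pin

/-- pinning lemma (total variation version) for probability
distributions over `Fin n → S`. -/
theorem stmt_10 {S : Type*} [Fintype S] [DecidableEq S] [Nonempty S]
    (n : ℕ) (hn : 1 ≤ n)
    (μ : (Fin n → S) → ℝ) (hμ0 : ∀ x, 0 ≤ μ x) (hμ1 : ∑ x, μ x = 1)
    (s : ℕ) (hs : 1 ≤ s) :
    ∃ T : Finset (Fin n), T.card ≤ s ∧
      ∑ y, μ y * ((1 / (n : ℝ) ^ 2) * ∑ i, ∑ j,
        tvFin (margPair (condDist μ T y) i j)
          (fun ab => margOne (condDist μ T y) i ab.1 * margOne (condDist μ T y) j ab.2))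
      ≤ Real.sqrt (Real.log (Fintype.card S) / s) := by
  obtain ⟨T, hT, hI⟩ := pin_exists hn μ hμ0 hμ1 s hs
  refine ⟨T, hT, ?_⟩
  apply Real.le_sqrt_of_sq_le
  refine le_trans ?_ hI
  have hn0 : (0 : ℝ) < n := by exact_mod_cast hn
  set t : (Fin n → S) → Fin n → Fin n → ℝ := fun y i j =>
    tvFin (margPair (condDist μ T y) i j)
      (fun ab => margOne (condDist μ T y) i ab.1 * margOne (condDist μ T y) j ab.2) with ht
  have h1 : (∑ y, μ y * ((1 / (n : ℝ) ^ 2) * ∑ i, ∑ j, t y i j)) ^ 2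
      ≤ ∑ y, μ y * ((1 / (n : ℝ) ^ 2) * ∑ i, ∑ j, t y i j) ^ 2 :=
    by
    have := (even_two.convexOn_pow (𝕜 := ℝ)).map_sum_le (t := univ) (w := μ)
      (p := fun y => (1 / (n : ℝ) ^ 2) * ∑ i, ∑ j, t y i j) (fun y _ => hμ0 y) hμ1
      (fun _ _ => Set.mem_univ _)
    simpa only [smul_eq_mul] using this
  have h2 : ∀ y, ((1 / (n : ℝ) ^ 2) * ∑ i, ∑ j, t y i j) ^ 2
      ≤ (1 / (n : ℝ) ^ 2) * ∑ i, ∑ j, t y i j ^ 2 := by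
    intro y
    have h := sq_sum_le_card_mul_sum_sq (s := (univ : Finset (Fin n × Fin n)))
      (f := fun ij => t y ij.1 ij.2)
    rw [Fintype.sum_prod_type, Fintype.sum_prod_type] at h
    simp only [card_univ, Fintype.card_prod, Fintype.card_fin, Nat.cast_mul] at h
    rw [mul_pow]
    calc _ ≤ (1 / (n : ℝ) ^ 2) ^ 2 * (n * n * ∑ i, ∑ j, t y i j ^ 2) := by gcongr
      _ = _ := by field_simp
  calc _ ≤ _ := h1
    _ ≤ ∑ y, μ y * ((1 / (n : ℝ) ^ 2) * ∑ i, ∑ j, t y i j ^ 2) :=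
        sum_le_sum fun y _ => mul_le_mul_of_nonneg_left (h2 y) (hμ0 y)
    _ = (1 / (n : ℝ) ^ 2) * ∑ i, ∑ j, ∑ y, μ y * t y i j ^ 2 := by
        simp only [mul_sum]
        rw [sum_comm]
        apply sum_congr rfl
        intro i _
        rw [sum_comm]
        apply sum_congr rfl
        intro j _
        apply sum_congr rfl
        intro y _
        ring
    _ ≤ _ := by
        gcongr with i _ j _
        exact pin_tv_sum μ hμ0 T i j
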